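/- arXiv:1509.06902 — 10 statements merged into one kernel-verified Lean document; each statement's English description precedes it below -/
import Mathlib

section
/- Let (h_L,v1_L,v2_L,B1_L,B2_L) and (h_R,v1_R,v2_R,B1_R,B2_R) be two SWMHD states with h_L, h_R > 0, g > 0, and cell widths Δx_L, Δx_R > 0, and assume {Δx B1} ≠ 0 and {Δx B2} ≠ 0. Then the entropy conserving flux f^{ec} and interface source term s satisfy the discrete entropy conservation condition ⟦q⟧ · f^{ec} = ½ g ⟦h² v1⟧ − ⟦h B1 (v1 B1 + v2 B2)⟧ − 2 {Δx q} · s, where q denotes the entropy variables of each state. -/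
open Matrix

noncomputable section

/-- Jump operator: ⟦a⟧ = a_R − a_L. -/
def jmp (l r : ℝ) : ℝ := r - l

/-- Average operator: {a} = (a_L + a_R)/2. -/
def avg (l r : ℝ) : ℝ := (l + r) / 2

/-- Entropy variables q = (g h − ½(v1²+v2²+B1²+B2²), v1, v2, B1, B2). -/
def qVec (g h v1 v2 B1 B2 : ℝ) : Fin 5 → ℝ :=
  ![g * h - (v1 ^ 2 + v2 ^ 2 + B1 ^ 2 + B2 ^ 2) / 2, v1, v2, B1, B2]

/-- Entropy conserving numerical flux f^{ec}. -/
def fec (g hL v1L v2L B1L B2L hR v1R v2R B1R B2R : ℝ) : Fin 5 → ℝ :=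
  ![avg hL hR * avg v1L v1R,
    avg hL hR * (avg v1L v1R) ^ 2 + g * avg (hL ^ 2) (hR ^ 2) / 2
      - avg (hL * B1L) (hR * B1R) * avg B1L B1R,
    avg hL hR * avg v1L v1R * avg v2L v2R - avg (hL * B1L) (hR * B1R) * avg B2L B2R,
    avg hL hR * avg v1L v1R * avg B1L B1R - avg (hL * B1L) (hR * B1R) * avg v1L v1R,
    avg hL hR * avg v1L v1R * avg B2L B2R - avg (hL * B1L) (hR * B1R) * avg v2L v2R]

/-- Interface source term s = −½ ⟦hB1⟧ (0,0,0,{v1B1}/{Δx B1},{v2B2}/{Δx B2}). -/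
def srcTerm (ΔxL ΔxR hL v1L v2L B1L B2L hR v1R v2R B1R B2R : ℝ) : Fin 5 → ℝ :=
  ![0, 0, 0,
    -(jmp (hL * B1L) (hR * B1R)) / 2 *
      (avg (v1L * B1L) (v1R * B1R) / avg (ΔxL * B1L) (ΔxR * B1R)),
    -(jmp (hL * B1L) (hR * B1R)) / 2 *
      (avg (v2L * B2L) (v2R * B2R) / avg (ΔxL * B2L) (ΔxR * B2R))]

/-- Discrete entropy conservation condition for the entropy conserving flux. -/
theorem discrete_entropy_conservation_condition
    (g ΔxL ΔxR hL v1L v2L B1L B2L hR v1R v2R B1R B2R : ℝ)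
    (hg : 0 < g) (hhL : 0 < hL) (hhR : 0 < hR)
    (hΔL : 0 < ΔxL) (hΔR : 0 < ΔxR)
    (hB1 : avg (ΔxL * B1L) (ΔxR * B1R) ≠ 0)
    (hB2 : avg (ΔxL * B2L) (ΔxR * B2R) ≠ 0) :
    (fun i => jmp (qVec g hL v1L v2L B1L B2L i) (qVec g hR v1R v2R B1R B2R i)) ⬝ᵥ
        fec g hL v1L v2L B1L B2L hR v1R v2R B1R B2R
      = g * jmp (hL ^ 2 * v1L) (hR ^ 2 * v1R) / 2
        - jmp (hL * B1L * (v1L * B1L + v2L * B2L)) (hR * B1R * (v1R * B1R + v2R * B2R))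
        - 2 * ((fun i => avg (ΔxL * qVec g hL v1L v2L B1L B2L i)
              (ΔxR * qVec g hR v1R v2R B1R B2R i)) ⬝ᵥ
            srcTerm ΔxL ΔxR hL v1L v2L B1L B2L hR v1R v2R B1R B2R) := by
  have source_cancel (a b c : ℝ) (hc : c ≠ 0) : c * (a / 2 * (b / c)) = a * b / 2 := by
    field_simp
  have source_dot :
      (fun i => avg (ΔxL * qVec g hL v1L v2L B1L B2L i)
          (ΔxR * qVec g hR v1R v2R B1R B2R i)) ⬝ᵥ
        srcTerm ΔxL ΔxR hL v1L v2L B1L B2L hR v1R v2R B1R B2R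
      = -(jmp (hL * B1L) (hR * B1R)) * avg (v1L * B1L) (v1R * B1R) / 2
        + -(jmp (hL * B1L) (hR * B1R)) * avg (v2L * B2L) (v2R * B2R) / 2 := by
    rw [← source_cancel _ _ _ hB1, ← source_cancel _ _ _ hB2]
    simp [dotProduct, Fin.sum_univ_five, qVec, srcTerm]
  rw [source_dot]
  simp only [dotProduct, Fin.sum_univ_five, qVec, fec, jmp, avg, Matrix.cons_val]
  ring
end
end

section
/- Let L, R be two SWMHD states with h_L, h_R > 0, g > 0, cell widths Δx_L, Δx_R > 0, {Δx B1} ≠ 0 and {Δx B2} ≠ 0. Then the entropy conserving flux and interface source term satisfy the discrete entropy conservation law: 2 {Δx q} · s − ⟦q · f⟧ + ⟦q⟧ · f^{ec} = −⟦F⟧, where f is the physical flux, q the entropy variables, and F the entropy flux of each state. -/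
open Matrix

noncomputable section

/-- Physical flux f. -/
def physFlux (g h v1 v2 B1 B2 : ℝ) : Fin 5 → ℝ :=
  ![h * v1, h * v1 ^ 2 + g * h ^ 2 / 2 - h * B1 ^ 2, h * v1 * v2 - h * B1 * B2, 0,
    h * v1 * B2 - h * v2 * B1]

/-- Entropy flux F. -/
def entFlux (g h v1 v2 B1 B2 : ℝ) : ℝ :=
  g * h ^ 2 * v1 + (h * v1 ^ 3 + h * v1 * v2 ^ 2 + h * v1 * B2 ^ 2 - h * v1 * B1 ^ 2) / 2
    - h * v2 * B1 * B2

/-- Discrete entropy conservation law: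
2 {Δx q}·s − ⟦q·f⟧ + ⟦q⟧·f^{ec} = −⟦F⟧. -/
theorem discrete_entropy_conservation_law
    (g ΔxL ΔxR hL v1L v2L B1L B2L hR v1R v2R B1R B2R : ℝ)
    (hg : 0 < g) (hhL : 0 < hL) (hhR : 0 < hR)
    (hΔL : 0 < ΔxL) (hΔR : 0 < ΔxR)
    (hB1 : avg (ΔxL * B1L) (ΔxR * B1R) ≠ 0)
    (hB2 : avg (ΔxL * B2L) (ΔxR * B2R) ≠ 0) :
    2 * ((fun i => avg (ΔxL * qVec g hL v1L v2L B1L B2L i)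
          (ΔxR * qVec g hR v1R v2R B1R B2R i)) ⬝ᵥ
        srcTerm ΔxL ΔxR hL v1L v2L B1L B2L hR v1R v2R B1R B2R)
      - jmp (qVec g hL v1L v2L B1L B2L ⬝ᵥ physFlux g hL v1L v2L B1L B2L)
          (qVec g hR v1R v2R B1R B2R ⬝ᵥ physFlux g hR v1R v2R B1R B2R)
      + (fun i => jmp (qVec g hL v1L v2L B1L B2L i) (qVec g hR v1R v2R B1R B2R i)) ⬝ᵥ
          fec g hL v1L v2L B1L B2L hR v1R v2R B1R B2R
      = -(jmp (entFlux g hL v1L v2L B1L B2L) (entFlux g hR v1R v2R B1R B2R)) := by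
  have cancel (a b d : ℝ) (hd : d ≠ 0) : d * (a * (b / d)) = a * b := by
    field_simp
  simp only [dotProduct, Fin.sum_univ_five, qVec, physFlux, fec, srcTerm, Matrix.cons_val,
    mul_zero, zero_add]
  rw [cancel _ _ _ hB1, cancel _ _ _ hB2]
  simp only [jmp, avg, entFlux]
  ring
end
end

section
/- Let g > 0 and (h,v1,v2,B1,B2) be an SWMHD state with h > 0, and set c² = g h. Then the 5×5 entropy Jacobian matrix H = (1/g) · [[1, v1, v2, B1, B2], [v1, v1²+c², v1 v2, v1 B1, v1 B2], [v2, v1 v2, v2²+c², v2 B1, v2 B2], [B1, v1 B1, v2 B1, B1²+c², B1 B2], [B2, v1 B2, v2 B2, B1 B2, B2²+c²]] is symmetric and positive definite. -/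
open Matrix

noncomputable section

/-- Entropy Jacobian H (with c² = g h). -/
def entH (g h v1 v2 B1 B2 : ℝ) : Matrix (Fin 5) (Fin 5) ℝ :=
  (1 / g) • !![1, v1, v2, B1, B2;
               v1, v1 ^ 2 + g * h, v1 * v2, v1 * B1, v1 * B2;
               v2, v1 * v2, v2 ^ 2 + g * h, v2 * B1, v2 * B2;
               B1, v1 * B1, v2 * B1, B1 ^ 2 + g * h, B1 * B2;
               B2, v1 * B2, v2 * B2, B1 * B2, B2 ^ 2 + g * h]

theorem entH_isSymm (g h v1 v2 B1 B2 : ℝ) : (entH g h v1 v2 B1 B2).IsSymm := by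
  ext i j
  fin_cases i <;> fin_cases j <;> simp [entH]

/-- The quadratic form of the entropy Jacobian as a weighted sum of squares. -/
theorem dotProduct_entH_mulVec {g : ℝ} (hg : g ≠ 0) (h v1 v2 B1 B2 : ℝ) (x : Fin 5 → ℝ) :
    x ⬝ᵥ (entH g h v1 v2 B1 B2 *ᵥ x) =
      (x 0 + v1 * x 1 + v2 * x 2 + B1 * x 3 + B2 * x 4) ^ 2 / g +
        h * (x 1 ^ 2 + x 2 ^ 2 + x 3 ^ 2 + x 4 ^ 2) := by
  simp [entH, dotProduct, mulVec, Fin.sum_univ_succ]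
  field_simp
  ring

/-- The entropy Jacobian is symmetric positive definite. -/
theorem entH_isSymm_posDef (g h v1 v2 B1 B2 : ℝ) (hg : 0 < g) (hh : 0 < h) :
    (entH g h v1 v2 B1 B2).IsSymm ∧ (entH g h v1 v2 B1 B2).PosDef := by
  refine ⟨entH_isSymm .., .of_dotProduct_mulVec_pos ?_ fun x hx => ?_⟩
  · rw [IsHermitian, conjTranspose_eq_transpose_of_trivial]
    exact entH_isSymm ..
  rw [star_trivial, dotProduct_entH_mulVec hg.ne']
  by_cases hr : x 1 ^ 2 + x 2 ^ 2 + x 3 ^ 2 + x 4 ^ 2 = 0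
  · have := sq_nonneg (x 1)
    have := sq_nonneg (x 2)
    have := sq_nonneg (x 3)
    have := sq_nonneg (x 4)
    have h1 : x 1 = 0 := sq_eq_zero_iff.1 (by linarith)
    have h2 : x 2 = 0 := sq_eq_zero_iff.1 (by linarith)
    have h3 : x 3 = 0 := sq_eq_zero_iff.1 (by linarith)
    have h4 : x 4 = 0 := sq_eq_zero_iff.1 (by linarith)
    have h0 : x 0 ≠ 0 := fun h0 => hx <| by
      ext i
      fin_cases i <;> assumption
    simp only [h1, h2, h3, h4]
    ring_nf
    positivity
  · have : 0 < x 1 ^ 2 + x 2 ^ 2 + x 3 ^ 2 + x 4 ^ 2 := lt_of_le_of_ne' (by positivity) hr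
    positivity
end
end

section
/- Let g > 0, (h,v1,v2,B1,B2) an SWMHD state with h > 0 and B1 ≠ 0, and c_g = √(g h + B1²). Then the Powell-modified flux Jacobian Â = [[0,1,0,0,0], [g h − v1² + B1², 2v1, 0, −B1, 0], [−v1 v2 + B1 B2, v2, v1, 0, −B1], [0,0,0,v1,0], [v2 B1 − v1 B2, B2, −B1, 0, v1]] satisfies the eigendecomposition identity Â · R̂ = R̂ · Λ, where R̂ = [[1,0,1,0,1], [v1−c_g,0,v1,0,v1+c_g], [v2,1,v2,1,v2], [0,0,c_g²/B1,0,0], [B2,1,B2,−1,B2]] and Λ = diag(v1−c_g, v1−B1, v1, v1+B1, v1+c_g); moreover R̂ is invertible. -/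
open Matrix

noncomputable section

/-- Magnetogravity wave speed c_g = √(g h + B1²). -/
def cg (g h B1 : ℝ) : ℝ := Real.sqrt (g * h + B1 ^ 2)

/-- Powell-modified flux Jacobian Â. -/
def powellJac (g h v1 v2 B1 B2 : ℝ) : Matrix (Fin 5) (Fin 5) ℝ :=
  !![0, 1, 0, 0, 0;
     g * h - v1 ^ 2 + B1 ^ 2, 2 * v1, 0, -B1, 0;
     -(v1 * v2) + B1 * B2, v2, v1, 0, -B1;
     0, 0, 0, v1, 0;
     v2 * B1 - v1 * B2, B2, -B1, 0, v1]

/-- Matrix of right eigenvectors R̂. -/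
def Rhat (g h v1 v2 B1 B2 : ℝ) : Matrix (Fin 5) (Fin 5) ℝ :=
  !![1, 0, 1, 0, 1;
     v1 - cg g h B1, 0, v1, 0, v1 + cg g h B1;
     v2, 1, v2, 1, v2;
     0, 0, (cg g h B1) ^ 2 / B1, 0, 0;
     B2, 1, B2, -1, B2]

theorem cg_sq {g h : ℝ} (hg : 0 < g) (hh : 0 < h) (B1 : ℝ) :
    cg g h B1 ^ 2 = g * h + B1 ^ 2 :=
  Real.sq_sqrt (by positivity)

theorem cg_pos {g h : ℝ} (hg : 0 < g) (hh : 0 < h) (B1 : ℝ) : 0 < cg g h B1 :=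
  Real.sqrt_pos.2 (by positivity)

theorem det_Rhat (g h v1 v2 B1 B2 : ℝ) :
    (Rhat g h v1 v2 B1 B2).det = 4 * cg g h B1 ^ 3 / B1 := by
  simp [Rhat, Matrix.det_succ_row_zero, Fin.sum_univ_succ, Fin.succAbove]
  ring

/-- Eigendecomposition of the Powell-modified flux Jacobian: Â R̂ = R̂ Λ with
Λ = diag(v1−c_g, v1−B1, v1, v1+B1, v1+c_g), and R̂ is invertible. -/
theorem powellJac_eigendecomposition (g h v1 v2 B1 B2 : ℝ)
    (hg : 0 < g) (hh : 0 < h) (hB1 : B1 ≠ 0) :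
    powellJac g h v1 v2 B1 B2 * Rhat g h v1 v2 B1 B2 =
        Rhat g h v1 v2 B1 B2 *
          Matrix.diagonal ![v1 - cg g h B1, v1 - B1, v1, v1 + B1, v1 + cg g h B1] ∧
      IsUnit (Rhat g h v1 v2 B1 B2) := by
  constructor
  · have hc := cg_sq hg hh B1
    ext i j
    fin_cases i <;> fin_cases j <;>
      simp [powellJac, Rhat, Matrix.mul_apply, Fin.sum_univ_succ, Matrix.diagonal_apply] <;>
      field_simp <;> linarith
  · rw [Matrix.isUnit_iff_isUnit_det, det_Rhat, isUnit_iff_ne_zero]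
    have := cg_pos hg hh B1
    positivity
end
end

section
/- Let g > 0, (h,v1,v2,B1,B2) an SWMHD state with h > 0 and B1 ≠ 0, c = √(g h), c_g = √(g h + B1²), R̂ = [[1,0,1,0,1], [v1−c_g,0,v1,0,v1+c_g], [v2,1,v2,1,v2], [0,0,c_g²/B1,0,0], [B2,1,B2,−1,B2]], |Λ| = diag(|v1−c_g|, |v1−B1|, |v1|, |v1+B1|, |v1+c_g|), and S = T² with T = diag(c/(c_g√(2g)), c/√(2g), B1/(c_g√g), c/√(2g), c/(c_g√(2g))). Then the dissipation matrix D = R̂ |Λ| S R̂ᵀ is symmetric positive semidefinite: for every w ∈ ℝ⁵, wᵀ D w ≥ 0. -/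
open Matrix

noncomputable section

/-- Wave speed c = √(g h). -/
def ws (g h : ℝ) : ℝ := Real.sqrt (g * h)

/-- Diagonal matrix of absolute values of the eigenvalues. -/
def absLambda (g h v1 B1 : ℝ) : Matrix (Fin 5) (Fin 5) ℝ :=
  Matrix.diagonal
    ![|v1 - cg g h B1|, |v1 - B1|, |v1|, |v1 + B1|, |v1 + cg g h B1|]

/-- Diagonal scaling matrix T. -/
def Tmat (g h B1 : ℝ) : Matrix (Fin 5) (Fin 5) ℝ :=
  Matrix.diagonal
    ![ws g h / (cg g h B1 * Real.sqrt (2 * g)),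
      ws g h / Real.sqrt (2 * g),
      B1 / (cg g h B1 * Real.sqrt g),
      ws g h / Real.sqrt (2 * g),
      ws g h / (cg g h B1 * Real.sqrt (2 * g))]

/-- The ES1 dissipation matrix D = R̂ |Λ| S R̂ᵀ, with S = T². -/
def dissES1 (g h v1 v2 B1 B2 : ℝ) : Matrix (Fin 5) (Fin 5) ℝ :=
  Rhat g h v1 v2 B1 B2 * absLambda g h v1 B1 * (Tmat g h B1 * Tmat g h B1) *
    (Rhat g h v1 v2 B1 B2)ᵀ

/-- A congruence `A Λ T² Aᵀ` by diagonal matrices `Λ ≥ 0` and `T` is positive semidefinite. -/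
theorem posSemidef_mul_diagonal_mul_sq_mul_transpose {m n : Type*} [Finite m]
    [Fintype n] [DecidableEq n]
    (A : Matrix m n ℝ) {l : n → ℝ} (t : n → ℝ) (hl : 0 ≤ l) :
    (A * diagonal l * (diagonal t * diagonal t) * Aᵀ).PosSemidef := by
  have hd : (diagonal fun i => l i * (t i * t i)).PosSemidef :=
    PosSemidef.diagonal fun i => mul_nonneg (hl i) (mul_self_nonneg (t i))
  simpa [Matrix.mul_assoc, conjTranspose_eq_transpose_of_trivial] using
    hd.mul_mul_conjTranspose_same A

/-- The dissipation matrix D = R̂ |Λ| S R̂ᵀ is symmetric positive semidefinite. -/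
theorem dissES1_symm_posSemidef (g h v1 v2 B1 B2 : ℝ)
    (hg : 0 < g) (hh : 0 < h) (hB1 : B1 ≠ 0) :
    (dissES1 g h v1 v2 B1 B2).IsSymm ∧
      ∀ w : Fin 5 → ℝ, 0 ≤ w ⬝ᵥ (dissES1 g h v1 v2 B1 B2).mulVec w := by
  have hl : (0 : Fin 5 → ℝ) ≤
      ![|v1 - cg g h B1|, |v1 - B1|, |v1|, |v1 + B1|, |v1 + cg g h B1|] := by
    intro i
    fin_cases i <;> exact abs_nonneg _
  have hD : (dissES1 g h v1 v2 B1 B2).PosSemidef :=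
    posSemidef_mul_diagonal_mul_sq_mul_transpose _ _ hl
  refine ⟨?_, fun w => by simpa using hD.dotProduct_mulVec_nonneg w⟩
  simpa [IsHermitian, IsSymm, conjTranspose_eq_transpose_of_trivial] using hD.isHermitian
end
end

section
/- Let L, R be two SWMHD states with h_L, h_R > 0, g > 0, cell widths Δx_L, Δx_R > 0, {Δx B1} ≠ 0 and {Δx B2} ≠ 0, and let D = R̂ |Λ| S R̂ᵀ be the ES1 dissipation matrix evaluated at any SWMHD state with depth h > 0 and B1 ≠ 0. Then the ES1 flux f^{ES1} = f^{ec} − ½ D ⟦q⟧ satisfies the entropy stability inequality ⟦q⟧ · f^{ES1} + 2 {Δx q} · s ≤ ½ g ⟦h² v1⟧ − ⟦h B1 (v1 B1 + v2 B2)⟧; in fact the difference of the two sides equals −½ ⟦q⟧ᵀ D ⟦q⟧ ≤ 0. -/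
open Matrix

noncomputable section

/-- The ES1 dissipation matrix is positive semidefinite. -/
theorem dissES1_quadratic_nonneg (g h v1 v2 B1 B2 : ℝ) (x : Fin 5 → ℝ) :
    0 ≤ x ⬝ᵥ (dissES1 g h v1 v2 B1 B2).mulVec x := by
  have key : x ⬝ᵥ (dissES1 g h v1 v2 B1 B2).mulVec x =
      (x ᵥ* Rhat g h v1 v2 B1 B2) ⬝ᵥ
        (absLambda g h v1 B1 * (Tmat g h B1 * Tmat g h B1)).mulVec
          (x ᵥ* Rhat g h v1 v2 B1 B2) := by
    rw [dissES1, Matrix.mul_assoc (Rhat g h v1 v2 B1 B2), ← mulVec_mulVec, ← mulVec_mulVec,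
      dotProduct_mulVec x, mulVec_transpose]
  rw [key, absLambda, Tmat, diagonal_mul_diagonal, diagonal_mul_diagonal]
  refine Finset.sum_nonneg fun i _ => ?_
  rw [mulVec_diagonal, mul_left_comm]
  refine mul_nonneg (mul_nonneg ?_ (mul_self_nonneg _)) (mul_self_nonneg _)
  fin_cases i <;> exact abs_nonneg _

/-- The flux `fec` together with the source term conserves entropy. -/
theorem fec_entropy_conservation
    (g ΔxL ΔxR hL v1L v2L B1L B2L hR v1R v2R B1R B2R : ℝ)
    (hB1avg : avg (ΔxL * B1L) (ΔxR * B1R) ≠ 0)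
    (hB2avg : avg (ΔxL * B2L) (ΔxR * B2R) ≠ 0) :
    (fun i => jmp (qVec g hL v1L v2L B1L B2L i) (qVec g hR v1R v2R B1R B2R i)) ⬝ᵥ
          fec g hL v1L v2L B1L B2L hR v1R v2R B1R B2R
        + 2 * ((fun i => avg (ΔxL * qVec g hL v1L v2L B1L B2L i)
              (ΔxR * qVec g hR v1R v2R B1R B2R i)) ⬝ᵥ
            srcTerm ΔxL ΔxR hL v1L v2L B1L B2L hR v1R v2R B1R B2R)
      = g * jmp (hL ^ 2 * v1L) (hR ^ 2 * v1R) / 2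
          - jmp (hL * B1L * (v1L * B1L + v2L * B2L)) (hR * B1R * (v1R * B1R + v2R * B2R)) := by
  have source :
      (fun i => avg (ΔxL * qVec g hL v1L v2L B1L B2L i)
          (ΔxR * qVec g hR v1R v2R B1R B2R i)) ⬝ᵥ
        srcTerm ΔxL ΔxR hL v1L v2L B1L B2L hR v1R v2R B1R B2R
      = -(jmp (hL * B1L) (hR * B1R)) / 2 *
          (avg (v1L * B1L) (v1R * B1R) + avg (v2L * B2L) (v2R * B2R)) := by
    simp only [dotProduct, Fin.sum_univ_five, srcTerm, qVec, cons_val]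
    field_simp
    ring
  rw [source]
  simp only [dotProduct, Fin.sum_univ_five, fec, qVec, cons_val, jmp, avg]
  ring

/-- Entropy stability of the ES1 flux f^{ES1} = f^{ec} − ½ D ⟦q⟧. -/
theorem ES1_entropy_stability
    (g ΔxL ΔxR hL v1L v2L B1L B2L hR v1R v2R B1R B2R h v1 v2 B1 B2 : ℝ)
    (hg : 0 < g) (hhL : 0 < hL) (hhR : 0 < hR)
    (hΔL : 0 < ΔxL) (hΔR : 0 < ΔxR)
    (hB1avg : avg (ΔxL * B1L) (ΔxR * B1R) ≠ 0)
    (hB2avg : avg (ΔxL * B2L) (ΔxR * B2R) ≠ 0)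
    (hh : 0 < h) (hB1 : B1 ≠ 0) :
    (fun i => jmp (qVec g hL v1L v2L B1L B2L i) (qVec g hR v1R v2R B1R B2R i)) ⬝ᵥ
          (fun i => fec g hL v1L v2L B1L B2L hR v1R v2R B1R B2R i
            - (dissES1 g h v1 v2 B1 B2).mulVec
                (fun j => jmp (qVec g hL v1L v2L B1L B2L j) (qVec g hR v1R v2R B1R B2R j)) i / 2)
        + 2 * ((fun i => avg (ΔxL * qVec g hL v1L v2L B1L B2L i)
              (ΔxR * qVec g hR v1R v2R B1R B2R i)) ⬝ᵥ
            srcTerm ΔxL ΔxR hL v1L v2L B1L B2L hR v1R v2R B1R B2R)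
        - (g * jmp (hL ^ 2 * v1L) (hR ^ 2 * v1R) / 2
            - jmp (hL * B1L * (v1L * B1L + v2L * B2L)) (hR * B1R * (v1R * B1R + v2R * B2R)))
      = -((fun i => jmp (qVec g hL v1L v2L B1L B2L i) (qVec g hR v1R v2R B1R B2R i)) ⬝ᵥ
            (dissES1 g h v1 v2 B1 B2).mulVec
              (fun j => jmp (qVec g hL v1L v2L B1L B2L j) (qVec g hR v1R v2R B1R B2R j))) / 2
    ∧
    (fun i => jmp (qVec g hL v1L v2L B1L B2L i) (qVec g hR v1R v2R B1R B2R i)) ⬝ᵥ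
          (fun i => fec g hL v1L v2L B1L B2L hR v1R v2R B1R B2R i
            - (dissES1 g h v1 v2 B1 B2).mulVec
                (fun j => jmp (qVec g hL v1L v2L B1L B2L j) (qVec g hR v1R v2R B1R B2R j)) i / 2)
        + 2 * ((fun i => avg (ΔxL * qVec g hL v1L v2L B1L B2L i)
              (ΔxR * qVec g hR v1R v2R B1R B2R i)) ⬝ᵥ
            srcTerm ΔxL ΔxR hL v1L v2L B1L B2L hR v1R v2R B1R B2R)
      ≤ g * jmp (hL ^ 2 * v1L) (hR ^ 2 * v1R) / 2
          - jmp (hL * B1L * (v1L * B1L + v2L * B2L)) (hR * B1R * (v1R * B1R + v2R * B2R)) := by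
  have conservation := fec_entropy_conservation g ΔxL ΔxR hL v1L v2L B1L B2L hR v1R v2R B1R B2R
    hB1avg hB2avg
  have dissipation := dissES1_quadratic_nonneg g h v1 v2 B1 B2
    (fun i => jmp (qVec g hL v1L v2L B1L B2L i) (qVec g hR v1R v2R B1R B2R i))
  have split (x f d : Fin 5 → ℝ) : x ⬝ᵥ (fun i => f i - d i / 2) = x ⬝ᵥ f - x ⬝ᵥ d / 2 := by
    simp only [dotProduct, Fin.sum_univ_five]
    ring
  rw [split]
  constructor <;> linarith
end
end

section
/- Let L, R be two SWMHD states with h_L, h_R > 0, g > 0, cell widths Δx_L, Δx_R > 0, {Δx B1} ≠ 0 and {Δx B2} ≠ 0. Then the y-direction entropy conserving flux g^{ec} and the y-direction interface source term s_y satisfy the discrete entropy conservation condition ⟦q⟧ · g^{ec} = ½ g ⟦h² v2⟧ − ⟦h B2 (v1 B1 + v2 B2)⟧ − 2 {Δx q} · s_y, where q denotes the entropy variables of each state. -/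
open Matrix

noncomputable section

/-- y-direction entropy conserving numerical flux g^{ec}. -/
def gec (g hL v1L v2L B1L B2L hR v1R v2R B1R B2R : ℝ) : Fin 5 → ℝ :=
  ![avg hL hR * avg v2L v2R,
    avg hL hR * avg v1L v1R * avg v2L v2R - avg (hL * B2L) (hR * B2R) * avg B1L B1R,
    avg hL hR * (avg v2L v2R) ^ 2 + g * avg (hL ^ 2) (hR ^ 2) / 2
      - avg (hL * B2L) (hR * B2R) * avg B2L B2R,
    avg hL hR * avg v2L v2R * avg B1L B1R - avg (hL * B2L) (hR * B2R) * avg v1L v1R,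
    avg hL hR * avg v2L v2R * avg B2L B2R - avg (hL * B2L) (hR * B2R) * avg v2L v2R]

/-- y-direction interface source term s_y. -/
def srcTermY (ΔxL ΔxR hL v1L v2L B1L B2L hR v1R v2R B1R B2R : ℝ) : Fin 5 → ℝ :=
  ![0, 0, 0,
    -(jmp (hL * B2L) (hR * B2R)) / 2 *
      (avg (v1L * B1L) (v1R * B1R) / avg (ΔxL * B1L) (ΔxR * B1R)),
    -(jmp (hL * B2L) (hR * B2R)) / 2 *
      (avg (v2L * B2L) (v2R * B2R) / avg (ΔxL * B2L) (ΔxR * B2R))]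

/-- Discrete entropy conservation condition in the y-direction. -/
theorem discrete_entropy_conservation_condition_y
    (g ΔxL ΔxR hL v1L v2L B1L B2L hR v1R v2R B1R B2R : ℝ)
    (hg : 0 < g) (hhL : 0 < hL) (hhR : 0 < hR)
    (hΔL : 0 < ΔxL) (hΔR : 0 < ΔxR)
    (hB1 : avg (ΔxL * B1L) (ΔxR * B1R) ≠ 0)
    (hB2 : avg (ΔxL * B2L) (ΔxR * B2R) ≠ 0) :
    (fun i => jmp (qVec g hL v1L v2L B1L B2L i) (qVec g hR v1R v2R B1R B2R i)) ⬝ᵥ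
        gec g hL v1L v2L B1L B2L hR v1R v2R B1R B2R
      = g * jmp (hL ^ 2 * v2L) (hR ^ 2 * v2R) / 2
        - jmp (hL * B2L * (v1L * B1L + v2L * B2L)) (hR * B2R * (v1R * B1R + v2R * B2R))
        - 2 * ((fun i => avg (ΔxL * qVec g hL v1L v2L B1L B2L i)
              (ΔxR * qVec g hR v1R v2R B1R B2R i)) ⬝ᵥ
            srcTermY ΔxL ΔxR hL v1L v2L B1L B2L hR v1R v2R B1R B2R) := by
  have cancel (J V A : ℝ) (hA : A ≠ 0) : A * (-J / 2 * (V / A)) = -J / 2 * V := by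
    field_simp
  simp only [dotProduct, Fin.sum_univ_five, qVec, gec, srcTermY, Matrix.cons_val, mul_zero,
    cancel _ _ _ hB1, cancel _ _ _ hB2]
  simp only [jmp, avg]
  ring
end
end

section
/- Let g > 0, (h,v1,v2,B1,B2) an SWMHD state with h > 0 and B2 ≠ 0, c = √(g h) and c_g = √(g h + B2²). With R̂_y = [[1,0,1,0,1], [v1,1,v1,1,v1], [v2−c_g,0,v2,0,v2+c_g], [B1,1,B1,−1,B1], [0,0,c_g²/B2,0,0]] and T_y = diag(c/(c_g√(2g)), c/√(2g), B2/(c_g√g), c/√(2g), c/(c_g√(2g))), the y-direction Merriam identity holds: (R̂_y T_y)(R̂_y T_y)ᵀ = R̂_y (T_y²) R̂_yᵀ = H, where H is the entropy Jacobian (1/g) · [[1, v1, v2, B1, B2], [v1, v1²+c², v1 v2, v1 B1, v1 B2], [v2, v1 v2, v2²+c², v2 B1, v2 B2], [B1, v1 B1, v2 B1, B1²+c², B1 B2], [B2, v1 B2, v2 B2, B1 B2, B2²+c²]]. -/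
open Matrix

noncomputable section

/-- y-direction magnetogravity wave speed c_g = √(g h + B2²). -/
def cgY (g h B2 : ℝ) : ℝ := Real.sqrt (g * h + B2 ^ 2)

/-- y-direction matrix of right eigenvectors R̂_y. -/
def RhatY (g h v1 v2 B1 B2 : ℝ) : Matrix (Fin 5) (Fin 5) ℝ :=
  !![1, 0, 1, 0, 1;
     v1, 1, v1, 1, v1;
     v2 - cgY g h B2, 0, v2, 0, v2 + cgY g h B2;
     B1, 1, B1, -1, B1;
     0, 0, (cgY g h B2) ^ 2 / B2, 0, 0]

/-- y-direction diagonal scaling matrix T_y. -/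
def TmatY (g h B2 : ℝ) : Matrix (Fin 5) (Fin 5) ℝ :=
  Matrix.diagonal
    ![ws g h / (cgY g h B2 * Real.sqrt (2 * g)),
      ws g h / Real.sqrt (2 * g),
      B2 / (cgY g h B2 * Real.sqrt g),
      ws g h / Real.sqrt (2 * g),
      ws g h / (cgY g h B2 * Real.sqrt (2 * g))]

/-- The squared scaling `T_y²` is free of square roots. -/
theorem TmatY_mul_self {g h : ℝ} (B2 : ℝ) (hg : 0 < g) (hh : 0 < h) :
    TmatY g h B2 * TmatY g h B2 = Matrix.diagonal
      ![g * h / ((g * h + B2 ^ 2) * (2 * g)), g * h / (2 * g), B2 ^ 2 / ((g * h + B2 ^ 2) * g),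
        g * h / (2 * g), g * h / ((g * h + B2 ^ 2) * (2 * g))] := by
  have hc : ws g h ^ 2 = g * h := Real.sq_sqrt (by positivity)
  have hcg : cgY g h B2 ^ 2 = g * h + B2 ^ 2 := Real.sq_sqrt (by positivity)
  have hsg : √g ^ 2 = g := Real.sq_sqrt hg.le
  rw [TmatY, Matrix.diagonal_mul_diagonal]
  congr 1
  funext i
  rw [← sq]
  fin_cases i <;> simp [div_pow, mul_pow, hc, hcg, hsg]

theorem RhatY_mul_TmatY_sq_mul_transpose {g h B2 : ℝ} (v1 v2 B1 : ℝ)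
    (hg : 0 < g) (hh : 0 < h) (hB2 : B2 ≠ 0) :
    RhatY g h v1 v2 B1 B2 * (TmatY g h B2 * TmatY g h B2) * (RhatY g h v1 v2 B1 B2)ᵀ =
      entH g h v1 v2 B1 B2 := by
  have hcg : cgY g h B2 ^ 2 = g * h + B2 ^ 2 := Real.sq_sqrt (by positivity)
  have hne : g * h + B2 ^ 2 ≠ 0 := by positivity
  rw [TmatY_mul_self B2 hg hh]
  simp only [RhatY, entH, hcg]
  generalize cgY g h B2 = k at hcg
  ext i j
  rw [Matrix.mul_apply]
  simp only [Matrix.mul_diagonal, Matrix.transpose_apply, Fin.sum_univ_five]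
  fin_cases i <;> fin_cases j <;> simp <;> field_simp <;> grind

/-- y-direction Merriam identity: (R̂_y T_y)(R̂_y T_y)ᵀ = R̂_y T_y² R̂_yᵀ = H. -/
theorem merriam_identity_y (g h v1 v2 B1 B2 : ℝ)
    (hg : 0 < g) (hh : 0 < h) (hB2 : B2 ≠ 0) :
    (RhatY g h v1 v2 B1 B2 * TmatY g h B2) * (RhatY g h v1 v2 B1 B2 * TmatY g h B2)ᵀ =
        entH g h v1 v2 B1 B2 ∧
      RhatY g h v1 v2 B1 B2 * (TmatY g h B2 * TmatY g h B2) * (RhatY g h v1 v2 B1 B2)ᵀ =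
        entH g h v1 v2 B1 B2 := by
  have key := RhatY_mul_TmatY_sq_mul_transpose v1 v2 B1 hg hh hB2
  have hT : (TmatY g h B2)ᵀ = TmatY g h B2 := Matrix.diagonal_transpose _
  refine ⟨?_, key⟩
  rw [← key, Matrix.transpose_mul, hT]
  simp only [Matrix.mul_assoc]
end
end

section
/- Let g > 0, (h,v1,v2,B1,B2) an SWMHD state with h > 0 and B2 ≠ 0, and c_g = √(g h + B2²). Then the y-direction Powell-modified flux Jacobian B̂ = [[0,0,1,0,0], [−v1 v2 + B1 B2, v2, v1, −B2, 0], [g h − v2² + B2², 0, 2v2, 0, −B2], [v1 B2 − v2 B1, −B2, B1, v2, 0], [0,0,0,0,v2]] satisfies the eigendecomposition identity B̂ · R̂_y = R̂_y · Λ_y, where R̂_y = [[1,0,1,0,1], [v1,1,v1,1,v1], [v2−c_g,0,v2,0,v2+c_g], [B1,1,B1,−1,B1], [0,0,c_g²/B2,0,0]] and Λ_y = diag(v2−c_g, v2−B2, v2, v2+B2, v2+c_g); moreover R̂_y is invertible. -/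
open Matrix

noncomputable section

/-- y-direction Powell-modified flux Jacobian B̂. -/
def powellJacY (g h v1 v2 B1 B2 : ℝ) : Matrix (Fin 5) (Fin 5) ℝ :=
  !![0, 0, 1, 0, 0;
     -(v1 * v2) + B1 * B2, v2, v1, -B2, 0;
     g * h - v2 ^ 2 + B2 ^ 2, 0, 2 * v2, 0, -B2;
     v1 * B2 - v2 * B1, -B2, B1, v2, 0;
     0, 0, 0, 0, v2]

theorem cgY_sq {g h : ℝ} (hg : 0 ≤ g) (hh : 0 ≤ h) (B2 : ℝ) :
    cgY g h B2 ^ 2 = g * h + B2 ^ 2 :=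
  Real.sq_sqrt (by positivity)

theorem cgY_pos {g h : ℝ} (hg : 0 < g) (hh : 0 < h) (B2 : ℝ) : 0 < cgY g h B2 :=
  Real.sqrt_pos.2 (by positivity)

theorem det_RhatY (g h v1 v2 B1 B2 : ℝ) :
    (RhatY g h v1 v2 B1 B2).det = 4 * cgY g h B2 * (cgY g h B2 ^ 2 / B2) := by
  simp [RhatY, Matrix.det_succ_row_zero, Fin.sum_univ_succ, Fin.succAbove]
  ring

/-- Eigendecomposition of the y-direction Powell-modified flux Jacobian:
B̂ R̂_y = R̂_y Λ_y with Λ_y = diag(v2−c_g, v2−B2, v2, v2+B2, v2+c_g), and R̂_y is invertible. -/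
theorem powellJacY_eigendecomposition (g h v1 v2 B1 B2 : ℝ)
    (hg : 0 < g) (hh : 0 < h) (hB2 : B2 ≠ 0) :
    powellJacY g h v1 v2 B1 B2 * RhatY g h v1 v2 B1 B2 =
        RhatY g h v1 v2 B1 B2 *
          Matrix.diagonal ![v2 - cgY g h B2, v2 - B2, v2, v2 + B2, v2 + cgY g h B2] ∧
      IsUnit (RhatY g h v1 v2 B1 B2) := by
  have hc := cgY_sq hg.le hh.le B2
  have hpos := cgY_pos hg hh B2
  refine ⟨?_, ?_⟩
  · have hdiv : B2 * (cgY g h B2 ^ 2 / B2) = cgY g h B2 ^ 2 := mul_div_cancel₀ _ hB2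
    ext i j
    rw [Matrix.mul_diagonal]
    fin_cases i <;> fin_cases j <;>
      simp [powellJacY, RhatY, Matrix.mul_apply, Fin.sum_univ_succ] <;> linarith
  · rw [Matrix.isUnit_iff_isUnit_det, det_RhatY, isUnit_iff_ne_zero]
    positivity
end
end

section
/- Eigenvector scaling (distinct-eigenvalue case): let n ≥ 1, let A ∈ ℝ^{n×n} be diagonalizable as A = R Λ R⁻¹ with R invertible and Λ diagonal with pairwise distinct diagonal entries, and let B ∈ ℝ^{n×n} be symmetric positive definite with A·B symmetric. Then there exists a diagonal matrix S with strictly positive diagonal entries such that B = R S Rᵀ, and consequently A·B = R Λ S Rᵀ. -/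
open Matrix

noncomputable section

/-- A symmetric matrix whose product with a diagonal matrix with pairwise distinct entries
is symmetric is itself diagonal. -/
theorem eq_diagonal_diag_of_isSymm_diagonal_mul {ι K : Type*} [Fintype ι] [DecidableEq ι]
    [Field K] {C : Matrix ι ι K} {d : ι → K} (hd : Function.Injective d)
    (hC : C.IsSymm) (hdC : (diagonal d * C).IsSymm) : C = diagonal C.diag := by
  ext i j
  by_cases hij : i = j
  · subst hij
    simp
  · have hcomm := hdC.apply i j
    rw [diagonal_mul, diagonal_mul, hC.apply i j] at hcomm
    rw [diagonal_apply_ne _ hij]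
    by_contra hne
    exact hij (hd (mul_right_cancel₀ hne hcomm)).symm

/-- Eigenvector scaling (distinct-eigenvalue case): if A = R Λ R⁻¹ with R invertible
and Λ diagonal with pairwise distinct entries, and B is a symmetric positive definite
right symmetrizer of A (i.e. A·B is symmetric), then there is a positive diagonal
matrix S with B = R S Rᵀ, and consequently A·B = R Λ S Rᵀ. -/
theorem eigenvector_scaling (n : ℕ) (hn : 1 ≤ n)
    (A B R : Matrix (Fin n) (Fin n) ℝ) (d : Fin n → ℝ)
    (hR : IsUnit R) (hd : Function.Injective d)
    (hA : A = R * Matrix.diagonal d * R⁻¹)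
    (hB : B.PosDef) (hAB : (A * B).IsSymm) :
    ∃ S : Fin n → ℝ, (∀ i, 0 < S i) ∧
      B = R * Matrix.diagonal S * Rᵀ ∧
      A * B = R * (Matrix.diagonal d * Matrix.diagonal S) * Rᵀ := by
  have hdet : IsUnit R.det := (isUnit_iff_isUnit_det R).mp hR
  have hdetT : IsUnit Rᵀ.det := by rwa [det_transpose]
  set C : Matrix (Fin n) (Fin n) ℝ := R⁻¹ * B * (R⁻¹)ᵀ with hC_def
  have hC : C.PosDef := by
    have hinj : Function.Injective (R⁻¹).vecMul :=
      vecMul_injective_of_isUnit ((isUnit_nonsing_inv_iff).mpr hR)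
    simpa [hC_def, conjTranspose_eq_transpose_of_trivial] using
      hB.mul_mul_conjTranspose_same hinj
  have hC_symm : C.IsSymm := by
    simpa [IsSymm, IsHermitian, conjTranspose_eq_transpose_of_trivial] using hC.isHermitian
  have hBC : B = R * C * Rᵀ := by
    simp only [hC_def, transpose_nonsing_inv, Matrix.mul_assoc]
    rw [nonsing_inv_mul _ hdetT, mul_nonsing_inv_cancel_left _ _ hdet, Matrix.mul_one]
  have hdC : diagonal d * C = R⁻¹ * (A * B) * (R⁻¹)ᵀ := by
    simp only [hC_def, hA, Matrix.mul_assoc]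
    rw [nonsing_inv_mul_cancel_left _ _ hdet]
  have hdC_symm : (diagonal d * C).IsSymm := by
    rw [hdC, IsSymm, transpose_mul, transpose_mul, transpose_transpose, hAB.eq,
      ← Matrix.mul_assoc]
  have hC_diag := eq_diagonal_diag_of_isSymm_diagonal_mul hd hC_symm hdC_symm
  refine ⟨C.diag, fun i => hC.diag_pos, ?_, ?_⟩
  · rwa [← hC_diag]
  · rw [← hC_diag, hA, hBC]
    simp only [Matrix.mul_assoc]
    rw [nonsing_inv_mul_cancel_left _ _ hdet]
end
end
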